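/- For p = 1/4, the unique bounded solutions E₁* and E₂* of the recurrences E(q) = 1 + r(q)·E(f₁(q)) and E(q) = 1 + r(q)·E(f₂(q)) on [0,1] satisfy E₁*(11/20) = 5/2 and E₂*(11/20) ≥ 323/128; in particular E₂*(11/20) > E₁*(11/20). -/

import Mathlib

noncomputable section

/-- The rescaling map `f₁`. -/
def f1 (p q : ℝ) : ℝ :=
  if q ≤ p then q / p
  else if q < 1 - p then (q - p) / (1 - p)
  else (q - (1 - p)) / p

/-- The rescaling map `f₂`, with breakpoint `1/2`. -/
def f2 (p q : ℝ) : ℝ :=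
  if q ≤ p then q / p
  else if q ≤ 1 / 2 then (q - p) / (1 - p)
  else if q < 1 - p then q / (1 - p)
  else (q - (1 - p)) / p

/-- The continuation probability `r`. -/
def r (p q : ℝ) : ℝ := if p < q ∧ q < 1 - p then 1 - p else p

/-- The unique bounded solution of `E(q) = 1 + r(q)·E(f₁(q))`. -/
def E1star (p q : ℝ) : ℝ := ∑' n : ℕ, ∏ j ∈ Finset.range n, r p ((f1 p)^[j] q)

/-- The unique bounded solution of `E(q) = 1 + r(q)·E(f₂(q))`. -/
def E2star (p q : ℝ) : ℝ := ∑' n : ℕ, ∏ j ∈ Finset.range n, r p ((f2 p)^[j] q)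

theorem r_nonneg {p : ℝ} (hp₀ : 0 ≤ p) (hp₁ : p ≤ 1) (q : ℝ) : 0 ≤ r p q := by
  unfold r
  split_ifs <;> linarith

theorem r_le_one_sub {p : ℝ} (hp : p ≤ 1 / 2) (q : ℝ) : r p q ≤ 1 - p := by
  unfold r
  split_ifs <;> linarith

theorem prod_r_nonneg {p : ℝ} (hp₀ : 0 ≤ p) (hp₁ : p ≤ 1) (g : ℝ → ℝ) (q : ℝ) (n : ℕ) :
    0 ≤ ∏ j ∈ Finset.range n, r p (g^[j] q) :=
  Finset.prod_nonneg fun _ _ => r_nonneg hp₀ hp₁ _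

/-- For `0 < p ≤ 1/2` the series of continuation probabilities along any orbit is dominated by
the geometric series of ratio `1 - p`. -/
theorem summable_prod_r {p : ℝ} (hp₀ : 0 < p) (hp : p ≤ 1 / 2) (g : ℝ → ℝ) (q : ℝ) :
    Summable fun n : ℕ => ∏ j ∈ Finset.range n, r p (g^[j] q) := by
  refine Summable.of_nonneg_of_le (prod_r_nonneg hp₀.le (by linarith) g q) (fun n => ?_)
    (summable_geometric_of_lt_one (r := 1 - p) (by linarith) (by linarith))
  calc ∏ j ∈ Finset.range n, r p (g^[j] q) ≤ ∏ _j ∈ Finset.range n, (1 - p) :=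
        Finset.prod_le_prod (fun _ _ => r_nonneg hp₀.le (by linarith) _)
          fun _ _ => r_le_one_sub hp _
    _ = (1 - p) ^ n := by simp

theorem tsum_prod_r_eq {p : ℝ} (hp₀ : 0 < p) (hp : p ≤ 1 / 2) (g : ℝ → ℝ) (q : ℝ) :
    ∑' n : ℕ, ∏ j ∈ Finset.range n, r p (g^[j] q) =
      1 + r p q * ∑' n : ℕ, ∏ j ∈ Finset.range n, r p (g^[j] (g q)) := by
  rw [(summable_prod_r hp₀ hp g q).tsum_eq_zero_add, ← tsum_mul_left]
  simp [Finset.prod_range_succ', mul_comm]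

theorem E1star_eq {p : ℝ} (hp₀ : 0 < p) (hp : p ≤ 1 / 2) (q : ℝ) :
    E1star p q = 1 + r p q * E1star p (f1 p q) :=
  tsum_prod_r_eq hp₀ hp (f1 p) q

theorem E2star_eq {p : ℝ} (hp₀ : 0 < p) (hp : p ≤ 1 / 2) (q : ℝ) :
    E2star p q = 1 + r p q * E2star p (f2 p q) :=
  tsum_prod_r_eq hp₀ hp (f2 p) q

theorem E2star_nonneg {p : ℝ} (hp₀ : 0 ≤ p) (hp₁ : p ≤ 1) (q : ℝ) : 0 ≤ E2star p q :=
  tsum_nonneg (prod_r_nonneg hp₀ hp₁ (f2 p) q)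

theorem E1star_eleven_twentieths : E1star (1/4) (11/20) = 5 / 2 := by
  have h := E1star_eq (p := 1/4) (by norm_num) (by norm_num)
  have h₀ := h (11/20)
  have h₁ := h (2/5)
  have h₂ := h (1/5)
  have h₃ := h (4/5)
  norm_num [r, f1] at h₀ h₁ h₂ h₃ ⊢
  linarith

theorem E2star_eleven_twentieths : 323 / 128 ≤ E2star (1/4) (11/20) := by
  have h := E2star_eq (p := 1/4) (by norm_num) (by norm_num)
  have h₀ := h (11/20)
  have h₁ := h (11/15)
  have h₂ := h (44/45)
  have h₃ := h (41/45)
  have h₄ := h (29/45)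
  have h₅ := h (116/135)
  have h₆ := h (59/135)
  have h₇ := h (101/405)
  have h₈ := E2star_nonneg (p := 1/4) (by norm_num) (by norm_num) (404/405)
  norm_num [r, f2] at h₀ h₁ h₂ h₃ h₄ h₅ h₆ h₇ h₈ ⊢
  linarith

/-- for `p = 1/4`, `E₁*(11/20) = 5/2` and `E₂*(11/20) ≥ 323/128`; in
particular `E₂*(11/20) > E₁*(11/20)`. -/
theorem E2star_gt_E1star_at_eleven_twentieths :
    E1star (1/4) (11/20) = 5 / 2 ∧
    323 / 128 ≤ E2star (1/4) (11/20) ∧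
    E1star (1/4) (11/20) < E2star (1/4) (11/20) := by
  refine ⟨E1star_eleven_twentieths, E2star_eleven_twentieths, ?_⟩
  rw [E1star_eleven_twentieths]
  exact lt_of_lt_of_le (by norm_num) E2star_eleven_twentieths
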